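/- arXiv:math/9707233 — 8 statements merged into one kernel-verified Lean document; each statement's English description precedes it below -/
import Mathlib

section
/- Let (A, v) and (B, w) be valued abelian groups and f : A → B a group homomorphism. Suppose there is a subset S ⊆ A such that: (a) for all s, s' ∈ S, v s ≤ v s' if and only if w(f s) ≤ w(f s'); (b) for all a ∈ A and s ∈ S, v a ≥ v s implies w(f a) ≥ w(f s); (c) for every b ∈ B with b ≠ 0 there is some s ∈ S with w(b − f s) > w b. If (A, v) is spherically complete, then f is surjective. -/
/-- A valued abelian group `(A, v)` is *spherically complete* if every nonempty nest of balls
(set of balls totally ordered by inclusion) has nonempty intersection, where the ball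
`B_α(a)` is `{a' | v (a - a') ≥ α}`. -/
def SphericallyComplete {A Γ : Type*} [AddCommGroup A] [LinearOrder Γ] (v : A → Γ) : Prop :=
  ∀ N : Set (Set A), (∀ X ∈ N, ∃ (a : A) (α : Γ), X = {a' : A | α ≤ v (a - a')}) →
    IsChain (· ⊆ ·) N → N.Nonempty → (⋂₀ N).Nonempty

section Ultrametric

variable {G Γ : Type*} [AddCommGroup G] [LinearOrder Γ] [OrderTop Γ] {v : G → Γ}

theorem ultrametric_neg (h_top : ∀ a : G, v a = ⊤ ↔ a = 0)
    (h_ultra : ∀ a a' : G, min (v a) (v a') ≤ v (a - a')) (a : G) : v (-a) = v a := by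
  have h_le : ∀ x, v x ≤ v (-x) := fun x => by
    simpa [(h_top 0).2 rfl] using h_ultra 0 x
  exact le_antisymm (by simpa using h_le (-a)) (h_le a)

theorem le_ultrametric_add (h_top : ∀ a : G, v a = ⊤ ↔ a = 0)
    (h_ultra : ∀ a a' : G, min (v a) (v a') ≤ v (a - a')) {γ : Γ} {a a' : G}
    (h : γ ≤ v a) (h' : γ ≤ v a') : γ ≤ v (a + a') := by
  have := h_ultra a (-a')
  rw [ultrametric_neg h_top h_ultra, sub_neg_eq_add] at this
  exact (le_min h h').trans this

theorem ultrametric_eq_of_lt_sub (h_top : ∀ a : G, v a = ⊤ ↔ a = 0)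
    (h_ultra : ∀ a a' : G, min (v a) (v a') ≤ v (a - a')) {a a' : G}
    (h : v a < v (a - a')) : v a' = v a := by
  apply le_antisymm
  · by_contra! hlt
    have := (lt_min h hlt).trans_le
      (le_ultrametric_add h_top h_ultra (min_le_left _ _) (min_le_right _ _))
    simp at this
  · simpa using (le_min le_rfl h.le).trans (h_ultra a (a - a'))

end Ultrametric

/-- In a spherically complete group, a step function `s` whose balls
`{a' | v (s a) ≤ v (a - a')}` have radii that do not decrease when the centre moves inside
the ball admits a point at which moving by `s` does not increase the radius. -/
theorem SphericallyComplete.exists_radius_add_le {A Γ : Type*} [AddCommGroup A] [LinearOrder Γ]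
    [OrderTop Γ] {v : A → Γ} (h_top : ∀ a : A, v a = ⊤ ↔ a = 0)
    (h_ultra : ∀ a a' : A, min (v a) (v a') ≤ v (a - a')) (hA : SphericallyComplete v)
    (s : A → A) (hs : ∀ a a', v (s a) ≤ v (a - a') → v (s a) ≤ v (s a')) :
    ∃ a, v (s (a + s a)) ≤ v (s a) := by
  have h_trans : ∀ {a b c : A}, v (s a) ≤ v (a - b) → v (s b) ≤ v (b - c) →
      v (s a) ≤ v (a - c) := fun {a b c} hab hbc => by
    simpa using le_ultrametric_add h_top h_ultra hab ((hs a b hab).trans hbc)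
  obtain ⟨m, hm⟩ := exists_maximal_of_chains_bounded
    (r := fun a a' => v (s a) ≤ v (a - a')) (fun c h_chain => by
      rcases c.eq_empty_or_nonempty with rfl | hne
      · exact ⟨0, by simp⟩
      have h_nest : IsChain (· ⊆ ·) ((fun a => {a' | v (s a) ≤ v (a - a')}) '' c) := by
        rintro _ ⟨a, ha, rfl⟩ _ ⟨b, hb, rfl⟩ hab
        rcases h_chain ha hb (fun h => hab (by rw [h])) with h | h
        · exact Or.inr fun x hx => h_trans h hx
        · exact Or.inl fun x hx => h_trans h hx
      obtain ⟨x, hx⟩ := hA _ (by rintro _ ⟨a, -, rfl⟩; exact ⟨a, v (s a), rfl⟩) h_nest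
        (hne.image _)
      exact ⟨x, fun a ha => hx _ ⟨a, ha, rfl⟩⟩) h_trans
  refine ⟨m, ?_⟩
  have h_neg := ultrametric_neg h_top h_ultra (s m)
  simpa using hm (m + s m) (by simp [h_neg])

theorem stmt_0 {A B ΓA ΓB : Type*} [AddCommGroup A] [AddCommGroup B]
    [LinearOrder ΓA] [OrderTop ΓA] [LinearOrder ΓB] [OrderTop ΓB]
    (v : A → ΓA) (w : B → ΓB)
    (hv_top : ∀ a : A, v a = ⊤ ↔ a = 0)
    (hv_ultra : ∀ a a' : A, min (v a) (v a') ≤ v (a - a'))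
    (hw_top : ∀ b : B, w b = ⊤ ↔ b = 0)
    (hw_ultra : ∀ b b' : B, min (w b) (w b') ≤ w (b - b'))
    (f : A →+ B) (S : Set A)
    (ha : ∀ s ∈ S, ∀ s' ∈ S, (v s ≤ v s' ↔ w (f s) ≤ w (f s')))
    (hb : ∀ a : A, ∀ s ∈ S, v s ≤ v a → w (f s) ≤ w (f a))
    (hc : ∀ b : B, b ≠ 0 → ∃ s ∈ S, w b < w (b - f s))
    (hA : SphericallyComplete v) :
    Function.Surjective f := by
  intro b
  by_contra! hne
  have h_step : ∀ a, ∃ s ∈ S, w (b - f a) < w (b - f a - f s) := fun a =>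
    hc _ (sub_ne_zero.2 (hne a).symm)
  choose s hsS hs using h_step
  have hw_s : ∀ a, w (f (s a)) = w (b - f a) := fun a =>
    ultrametric_eq_of_lt_sub hw_top hw_ultra (hs a)
  obtain ⟨a, h_le⟩ := hA.exists_radius_add_le hv_top hv_ultra s fun a a' h => by
    rw [ha _ (hsS a) _ (hsS a'), hw_s a']
    have hf := hb _ _ (hsS a) h
    rw [map_sub] at hf
    simpa using le_ultrametric_add hw_top hw_ultra (hw_s a).le hf
  rw [ha _ (hsS _) _ (hsS _), hw_s, hw_s, map_add, ← sub_sub] at h_le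
  exact (hs a).not_ge h_le
end

section
/- Let (A, v) and (B, w) be valued abelian groups and f : A → B a group homomorphism. Suppose there is a subset S ⊆ A such that: (a) for all s, s' ∈ S, v s ≤ v s' if and only if w(f s) ≤ w(f s'); (b) for all a ∈ A and s ∈ S, v a ≥ v s implies w(f a) ≥ w(f s); (c) for every b ∈ B with b ≠ 0 there is some s ∈ S with w(b − f s) > w b. If (A, v) is spherically complete, then (B, w) is spherically complete, i.e., every nonempty nest of balls in (B, w) has nonempty intersection. -/
theorem valued_sub_comm {A Γ : Type*} [AddCommGroup A] [LinearOrder Γ] [OrderTop Γ] {v : A → Γ}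
    (htop : ∀ a : A, v a = ⊤ ↔ a = 0) (hultra : ∀ a a' : A, min (v a) (v a') ≤ v (a - a'))
    (a a' : A) : v (a - a') = v (a' - a) := by
  have key : ∀ x : A, v x ≤ v (-x) := fun x => by
    simpa [(htop 0).2 rfl] using hultra 0 x
  apply le_antisymm
  · simpa using key (a - a')
  · simpa using key (a' - a)

theorem valued_sub_triangle {A Γ : Type*} [AddCommGroup A] [LinearOrder Γ] [OrderTop Γ] {v : A → Γ}
    (htop : ∀ a : A, v a = ⊤ ↔ a = 0) (hultra : ∀ a a' : A, min (v a) (v a') ≤ v (a - a'))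
    (a b c : A) : min (v (a - b)) (v (b - c)) ≤ v (a - c) := by
  have h := hultra (a - b) (c - b)
  rwa [sub_sub_sub_cancel_right, valued_sub_comm htop hultra c b] at h


theorem stmt_1 {A B ΓA ΓB : Type*} [AddCommGroup A] [AddCommGroup B]
    [LinearOrder ΓA] [OrderTop ΓA] [LinearOrder ΓB] [OrderTop ΓB]
    (v : A → ΓA) (w : B → ΓB)
    (hv_top : ∀ a : A, v a = ⊤ ↔ a = 0)
    (hv_ultra : ∀ a a' : A, min (v a) (v a') ≤ v (a - a'))
    (hw_top : ∀ b : B, w b = ⊤ ↔ b = 0)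
    (hw_ultra : ∀ b b' : B, min (w b) (w b') ≤ w (b - b'))
    (f : A →+ B) (S : Set A)
    (ha : ∀ s ∈ S, ∀ s' ∈ S, (v s ≤ v s' ↔ w (f s) ≤ w (f s')))
    (hb : ∀ a : A, ∀ s ∈ S, v s ≤ v a → w (f s) ≤ w (f a))
    (hc : ∀ b : B, b ≠ 0 → ∃ s ∈ S, w b < w (b - f s))
    (hA : SphericallyComplete v) :
    SphericallyComplete w := by
  have v_comm := valued_sub_comm hv_top hv_ultra
  have w_comm := valued_sub_comm hw_top hw_ultra
  have v_tri := valued_sub_triangle hv_top hv_ultra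
  have w_tri := valued_sub_triangle hw_top hw_ultra
  have v_zero : v 0 = ⊤ := (hv_top 0).2 rfl
  have w_zero : w 0 = ⊤ := (hw_top 0).2 rfl
  intro N hN hchain _
  by_contra hempty
  have step : ∀ a : A, ∃ s ∈ S, ∃ (b : B) (α : ΓB), {b' : B | α ≤ w (b - b')} ∈ N ∧
      w (b - f a) < α ∧ w (f s) = w (b - f a) ∧ w (b - f a) < w (b - f (a + s)) := by
    intro a
    obtain ⟨X, hX, haX⟩ : ∃ X ∈ N, f a ∉ X := by
      by_contra! h
      exact hempty ⟨f a, h⟩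
    obtain ⟨b, α, rfl⟩ := hN X hX
    have hlt : w (b - f a) < α := not_le.1 haX
    have hne : b - f a ≠ 0 := fun h => by
      rw [h, w_zero] at hlt
      exact not_top_lt hlt
    obtain ⟨s, hs, hsw⟩ := hc _ hne
    refine ⟨s, hs, b, α, hX, hlt, ?_, by rwa [map_add, ← sub_sub]⟩
    apply le_antisymm
    · by_contra! h
      have h₁ := w_tri (b - f a) (f s) 0
      rw [sub_zero, sub_zero] at h₁
      exact absurd h₁ (not_le.2 (lt_min hsw h))
    · have h₁ := w_tri (f s) (b - f a) 0
      rw [sub_zero, sub_zero, w_comm (f s), min_eq_right hsw.le] at h₁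
      exact h₁
  choose s hs b α hbN hlt hws himp using step
  have lower : ∀ a a' : A, min (α a) (w (b a - f a')) ≤ w (f (s a')) := by
    intro a a'
    rw [hws a']
    have h := w_tri (b a') (b a) (f a')
    rcases hchain.total (hbN a') (hbN a) with hsub | hsub
    · have h₁ : α a ≤ w (b a - b a') :=
        hsub (show α a' ≤ w (b a' - b a') by simp [w_zero])
      rw [w_comm] at h₁
      exact (min_le_min_right _ h₁).trans h
    · have h₁ : α a' ≤ w (b a' - b a) :=
        hsub (show α a ≤ w (b a - b a) by simp [w_zero])
      rcases min_le_iff.1 h with h₂ | h₂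
      · exact absurd (h₁.trans h₂) (not_le.2 (hlt a'))
      · exact (min_le_right _ _).trans h₂
  let D : A → Set A := fun a => {a' : A | v (s a) ≤ v (a - a')}
  have D_anti : ∀ a, ∀ a' ∈ D a, D a' ⊆ D a := by
    intro a a' ha' x hx
    have h₁ : w (f (s a)) ≤ w (f a - f a') := by
      rw [← map_sub]
      exact hb _ _ (hs a) ha'
    have h₂ : w (f (s a)) ≤ w (b a - f a') :=
      (le_min (hws a).le h₁).trans (w_tri _ _ _)
    have h₃ : v (s a) ≤ v (s a') := (ha _ (hs a) _ (hs a')).2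
      ((le_min ((hws a).trans_lt (hlt a)).le h₂).trans (lower a a'))
    exact (le_min ha' (h₃.trans hx)).trans (v_tri a a' x)
  have self_mem : ∀ a, a ∈ D a := fun a => by simp [D, v_zero]
  obtain ⟨M, hM⟩ := zorn_superset (Set.range D) (by
    intro c hcD hc_chain
    rcases c.eq_empty_or_nonempty with rfl | hne
    · exact ⟨D 0, ⟨0, rfl⟩, by simp⟩
    · obtain ⟨x, hx⟩ := hA c (fun X hX => by
        obtain ⟨a, rfl⟩ := hcD hX
        exact ⟨a, v (s a), rfl⟩) hc_chain hne
      refine ⟨D x, ⟨x, rfl⟩, fun X hX => ?_⟩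
      obtain ⟨a, rfl⟩ := hcD hX
      exact D_anti a x (hx _ hX))
  obtain ⟨a, rfl⟩ := hM.prop
  have hshift : v (a - (a + s a)) = v (s a) := by
    rw [v_comm, add_sub_cancel_left]
  have hmem : a ∈ D (a + s a) :=
    hM.le_of_le ⟨_, rfl⟩ (D_anti a (a + s a) hshift.ge) (self_mem a)
  have hle : v (s (a + s a)) ≤ v (s a) := by
    rw [← hshift, v_comm]
    exact hmem
  have hfle := (ha _ (hs _) _ (hs a)).1 hle
  have hlow := (lower a (a + s a)).trans hfle
  rw [hws a] at hlow
  exact absurd hlow (not_le.2 (lt_min (hlt a) (himp a)))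
end

section
/- Let (A, v) and (B, w) be valued abelian groups and f : A → B a group homomorphism, and suppose there is a subset S ⊆ A satisfying conditions (a), (b), (c): (a) for all s, s' ∈ S, v s ≤ v s' if and only if w(f s) ≤ w(f s'); (b) for all a ∈ A and s ∈ S, v a ≥ v s implies w(f a) ≥ w(f s); (c) for every b ∈ B with b ≠ 0 there is some s ∈ S with w(b − f s) > w b. If (A, v) is spherically complete, then for every a ∈ A and every s₀ ∈ S, the image of the ball B_{v s₀}(a) under f equals the ball B_{w(f s₀)}(f a), i.e., f(B_{v s₀}(a)) = B_{w(f s₀)}(f a). -/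
section ValuedGroup

variable {A Γ : Type*} [AddCommGroup A] [LinearOrder Γ] [OrderTop Γ] {v : A → Γ}

theorem le_neg_of_ultrametric (h_top : ∀ a : A, v a = ⊤ ↔ a = 0)
    (h_ultra : ∀ a a' : A, min (v a) (v a') ≤ v (a - a')) (a : A) : v a ≤ v (-a) := by
  simpa [(h_top 0).2 rfl] using h_ultra 0 a

theorem neg_eq_of_ultrametric (h_top : ∀ a : A, v a = ⊤ ↔ a = 0)
    (h_ultra : ∀ a a' : A, min (v a) (v a') ≤ v (a - a')) (a : A) : v (-a) = v a :=
  le_antisymm (by simpa using le_neg_of_ultrametric h_top h_ultra (-a))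
    (le_neg_of_ultrametric h_top h_ultra a)

theorem min_le_add_of_ultrametric (h_top : ∀ a : A, v a = ⊤ ↔ a = 0)
    (h_ultra : ∀ a a' : A, min (v a) (v a') ≤ v (a - a')) (a a' : A) :
    min (v a) (v a') ≤ v (a + a') := by
  simpa [neg_eq_of_ultrametric h_top h_ultra] using h_ultra a (-a')

theorem eq_of_lt_sub_of_ultrametric (h_top : ∀ a : A, v a = ⊤ ↔ a = 0)
    (h_ultra : ∀ a a' : A, min (v a) (v a') ≤ v (a - a')) {a a' : A} (h : v a < v (a - a')) :
    v a' = v a := by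
  apply le_antisymm
  · have h₁ := min_le_add_of_ultrametric h_top h_ultra (a - a') a'
    rw [sub_add_cancel] at h₁
    rcases min_le_iff.1 h₁ with h₂ | h₂
    · exact absurd h₂ (not_le.2 h)
    · exact h₂
  · have h₁ := h_ultra a (a - a')
    rwa [sub_sub_cancel, min_eq_left h.le] at h₁

end ValuedGroup

/-- If `v` is spherically complete, an element of value at least `w (f s₀)` is the
image of an element of value at least `v s₀`. -/
theorem SphericallyComplete.exists_map_eq {A B ΓA ΓB : Type*} [AddCommGroup A] [AddCommGroup B]
    [LinearOrder ΓA] [OrderTop ΓA] [LinearOrder ΓB] [OrderTop ΓB]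
    {v : A → ΓA} {w : B → ΓB}
    (hv_top : ∀ a : A, v a = ⊤ ↔ a = 0)
    (hv_ultra : ∀ a a' : A, min (v a) (v a') ≤ v (a - a'))
    (hw_top : ∀ b : B, w b = ⊤ ↔ b = 0)
    (hw_ultra : ∀ b b' : B, min (w b) (w b') ≤ w (b - b'))
    (f : A →+ B) {S : Set A}
    (ha : ∀ s ∈ S, ∀ s' ∈ S, (v s ≤ v s' ↔ w (f s) ≤ w (f s')))
    (hb : ∀ a : A, ∀ s ∈ S, v s ≤ v a → w (f s) ≤ w (f a))
    (hc : ∀ b : B, b ≠ 0 → ∃ s ∈ S, w b < w (b - f s))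
    (hA : SphericallyComplete v) {s₀ : A} (hs₀ : s₀ ∈ S) {b : B} (hb₀ : w (f s₀) ≤ w b) :
    ∃ x, v s₀ ≤ v x ∧ f x = b := by
  by_contra! hne
  have h_step : ∀ x, ∃ s, v s₀ ≤ v x →
      s ∈ S ∧ v s₀ ≤ v s ∧ w (f s) = w (b - f x) ∧ w (b - f x) < w (b - f (x + s)) := by
    intro x
    by_cases hx : v s₀ ≤ v x
    · obtain ⟨s, hs, hlt⟩ := hc (b - f x) (sub_ne_zero.2 (hne x hx).symm)
      have heq := eq_of_lt_sub_of_ultrametric hw_top hw_ultra hlt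
      refine ⟨s, fun _ => ⟨hs, ?_, heq, by rwa [map_add, ← sub_sub]⟩⟩
      rw [ha s₀ hs₀ s hs, heq]
      exact (le_min hb₀ (hb x s₀ hs₀ hx)).trans (hw_ultra _ _)
    · exact ⟨0, fun h => absurd h hx⟩
  choose s hs using h_step
  let ball : A → Set A := fun x => {a | v (s x) ≤ v (x - a)}
  have h_value : ∀ x, v s₀ ≤ v x → ∀ y ∈ ball x, v s₀ ≤ v y := by
    intro x hx y hy
    have h := hv_ultra x (x - y)
    rw [sub_sub_cancel] at h
    exact (le_min hx ((hs x hx).2.1.trans hy)).trans h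
  have h_subset : ∀ x, v s₀ ≤ v x → ∀ y ∈ ball x, ball y ⊆ ball x := by
    intro x hx y hy z hz
    obtain ⟨hsx, -, hwx, -⟩ := hs x hx
    obtain ⟨hsy, -, hwy, -⟩ := hs y (h_value x hx y hy)
    have h_radius : v (s x) ≤ v (s y) := by
      rw [ha _ hsx _ hsy, hwy]
      have h := min_le_add_of_ultrametric hw_top hw_ultra (b - f x) (f (x - y))
      rw [map_sub, sub_add_sub_cancel, ← map_sub] at h
      exact (le_min hwx.le (hb _ _ hsx hy)).trans h
    have h := min_le_add_of_ultrametric hv_top hv_ultra (x - y) (y - z)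
    rw [sub_add_sub_cancel] at h
    exact (le_min hy (h_radius.trans hz)).trans h
  obtain ⟨m, hm⟩ := zorn_superset (ball '' {x | v s₀ ≤ v x}) (by
    intro N hN hchain
    rcases N.eq_empty_or_nonempty with rfl | hN_ne
    · exact ⟨_, ⟨s₀, le_rfl, rfl⟩, by simp⟩
    · obtain ⟨y, hy⟩ := hA N (fun X hX => by
        obtain ⟨x, -, rfl⟩ := hN hX
        exact ⟨x, v (s x), rfl⟩) hchain hN_ne
      refine ⟨ball y, ⟨y, ?_, rfl⟩, fun X hX => ?_⟩
      · obtain ⟨X, hX⟩ := hN_ne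
        obtain ⟨x, hx, rfl⟩ := hN hX
        exact h_value x hx y (hy _ hX)
      · obtain ⟨x, hx, rfl⟩ := hN hX
        exact h_subset x hx y (hy _ hX))
  obtain ⟨⟨x, hx, rfl⟩, hmin⟩ := hm
  obtain ⟨hsx, -, hwx, hlt⟩ := hs x hx
  have h_mem : x + s x ∈ ball x := by
    change v (s x) ≤ v (x - (x + s x))
    rw [sub_add_cancel_left, neg_eq_of_ultrametric hv_top hv_ultra]
  have hx' := h_value x hx _ h_mem
  obtain ⟨hsx', -, hwx', -⟩ := hs _ hx'
  have h_center : x ∈ ball x := by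
    change v (s x) ≤ v (x - x)
    rw [sub_self, (hv_top 0).2 rfl]
    exact le_top
  have h_le : v (s (x + s x)) ≤ v (x + s x - x) :=
    hmin ⟨_, hx', rfl⟩ (h_subset x hx _ h_mem) h_center
  rw [add_sub_cancel_left, ha _ hsx' _ hsx, hwx, hwx'] at h_le
  exact h_le.not_gt hlt

theorem stmt_2 {A B ΓA ΓB : Type*} [AddCommGroup A] [AddCommGroup B]
    [LinearOrder ΓA] [OrderTop ΓA] [LinearOrder ΓB] [OrderTop ΓB]
    (v : A → ΓA) (w : B → ΓB)
    (hv_top : ∀ a : A, v a = ⊤ ↔ a = 0)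
    (hv_ultra : ∀ a a' : A, min (v a) (v a') ≤ v (a - a'))
    (hw_top : ∀ b : B, w b = ⊤ ↔ b = 0)
    (hw_ultra : ∀ b b' : B, min (w b) (w b') ≤ w (b - b'))
    (f : A →+ B) (S : Set A)
    (ha : ∀ s ∈ S, ∀ s' ∈ S, (v s ≤ v s' ↔ w (f s) ≤ w (f s')))
    (hb : ∀ a : A, ∀ s ∈ S, v s ≤ v a → w (f s) ≤ w (f a))
    (hc : ∀ b : B, b ≠ 0 → ∃ s ∈ S, w b < w (b - f s))
    (hA : SphericallyComplete v) :
    ∀ a : A, ∀ s₀ ∈ S,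
      f '' {a' : A | v s₀ ≤ v (a - a')} = {b' : B | w (f s₀) ≤ w (f a - b')} := by
  intro a s₀ hs₀
  ext b
  constructor
  · rintro ⟨x, hx, rfl⟩
    simpa using hb (a - x) s₀ hs₀ hx
  · intro h
    obtain ⟨x, hx, hfx⟩ := hA.exists_map_eq hv_top hv_ultra hw_top hw_ultra f ha hb hc hs₀ h
    exact ⟨a - x, by simpa using hx, by simp [hfx]⟩
end

section
/- Let (A, v) and (B, w) be valued abelian groups and f : A → B a group homomorphism, and suppose there is a subset S ⊆ A satisfying conditions (a), (b), (c): (a) for all s, s' ∈ S, v s ≤ v s' if and only if w(f s) ≤ w(f s'); (b) for all a ∈ A and s ∈ S, v a ≥ v s implies w(f a) ≥ w(f s); (c) for every b ∈ B with b ≠ 0 there is some s ∈ S with w(b − f s) > w b. If (A, v) is spherically complete, then for every b ∈ B: either b = 0, or b = f s for some s ∈ S, or there exist a ∈ S and s₀ ∈ S with v s₀ > v a and b ∈ f(B_{v s₀}(a)). -/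
section Ultrametric

variable {G Γ : Type*} [AddCommGroup G] [LinearOrder Γ] [OrderTop Γ] {v : G → Γ}

theorem valuation_neg (htop : ∀ a : G, v a = ⊤ ↔ a = 0)
    (hultra : ∀ a a' : G, min (v a) (v a') ≤ v (a - a')) (x : G) : v (-x) = v x := by
  have key : ∀ y : G, v y ≤ v (-y) := fun y => by
    have h := hultra 0 y
    rwa [(htop 0).2 rfl, min_eq_right le_top, zero_sub] at h
  exact le_antisymm (by simpa using key (-x)) (key x)

theorem valuation_sub_comm (htop : ∀ a : G, v a = ⊤ ↔ a = 0)
    (hultra : ∀ a a' : G, min (v a) (v a') ≤ v (a - a')) (x y : G) : v (x - y) = v (y - x) := by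
  rw [← neg_sub, valuation_neg htop hultra]

theorem le_valuation_sub_trans (htop : ∀ a : G, v a = ⊤ ↔ a = 0)
    (hultra : ∀ a a' : G, min (v a) (v a') ≤ v (a - a')) {γ : Γ} {x y z : G}
    (hxy : γ ≤ v (x - y)) (hyz : γ ≤ v (y - z)) : γ ≤ v (x - z) := by
  have h := hultra (x - y) (z - y)
  rw [sub_sub_sub_cancel_right, valuation_sub_comm htop hultra z y] at h
  exact (le_min hxy hyz).trans h

theorem valuation_eq_of_lt_sub (htop : ∀ a : G, v a = ⊤ ↔ a = 0)
    (hultra : ∀ a a' : G, min (v a) (v a') ≤ v (a - a')) {x y : G}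
    (h : v x < v (x - y)) : v y = v x := by
  have h1 := hultra x (x - y)
  rw [sub_sub_cancel, min_eq_left h.le] at h1
  refine le_antisymm ?_ h1
  by_contra! hlt
  have h2 := hultra (x - y) (-y)
  rw [valuation_neg htop hultra, sub_neg_eq_add, sub_add_cancel] at h2
  exact (lt_min h hlt).not_ge h2

end Ultrametric

theorem stmt_3 {A B ΓA ΓB : Type*} [AddCommGroup A] [AddCommGroup B]
    [LinearOrder ΓA] [OrderTop ΓA] [LinearOrder ΓB] [OrderTop ΓB]
    (v : A → ΓA) (w : B → ΓB)
    (hv_top : ∀ a : A, v a = ⊤ ↔ a = 0)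
    (hv_ultra : ∀ a a' : A, min (v a) (v a') ≤ v (a - a'))
    (hw_top : ∀ b : B, w b = ⊤ ↔ b = 0)
    (hw_ultra : ∀ b b' : B, min (w b) (w b') ≤ w (b - b'))
    (f : A →+ B) (S : Set A)
    (ha : ∀ s ∈ S, ∀ s' ∈ S, (v s ≤ v s' ↔ w (f s) ≤ w (f s')))
    (hb : ∀ a : A, ∀ s ∈ S, v s ≤ v a → w (f s) ≤ w (f a))
    (hc : ∀ b : B, b ≠ 0 → ∃ s ∈ S, w b < w (b - f s))
    (hA : SphericallyComplete v) :
    ∀ b : B, b = 0 ∨ (∃ s ∈ S, b = f s) ∨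
      ∃ a ∈ S, ∃ s₀ ∈ S, v a < v s₀ ∧ b ∈ f '' {a' : A | v s₀ ≤ v (a - a')} := by
  intro b
  rw [or_iff_not_imp_left, or_iff_not_imp_left]
  intro hb0 hbS
  have approx : ∀ c : B, c ≠ 0 → ∃ s ∈ S, w c < w (c - f s) ∧ w (f s) = w c := fun c hc0 => by
    obtain ⟨s, hs, hlt⟩ := hc c hc0
    exact ⟨s, hs, hlt, valuation_eq_of_lt_sub hw_top hw_ultra hlt⟩
  have lt_of_lt : ∀ s ∈ S, ∀ s' ∈ S, w (f s) < w (f s') → v s < v s' := fun s hs s' hs' h =>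
    lt_of_not_ge fun h' => h.not_ge ((ha s' hs' s hs).1 h')
  have v_self : ∀ (x : A) (γ : ΓA), γ ≤ v (x - x) := fun x γ => by
    rw [sub_self, (hv_top 0).2 rfl]
    exact le_top
  obtain ⟨a₀, ha₀, hlt₀, heq₀⟩ := approx b hb0
  have hne₀ : b - f a₀ ≠ 0 := fun h => hbS ⟨a₀, ha₀, sub_eq_zero.1 h⟩
  obtain ⟨s₁, hs₁, hlt₁, heq₁⟩ := approx _ hne₀
  refine ⟨a₀, ha₀, s₁, hs₁, lt_of_lt _ ha₀ _ hs₁ (by rwa [heq₀, heq₁]), ?_⟩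
  by_contra hcon
  have hne : ∀ x, v s₁ ≤ v (a₀ - x) → b - f x ≠ 0 := fun x hx h =>
    hcon ⟨x, hx, (sub_eq_zero.1 h).symm⟩
  let r : A × A → A × A → Prop := fun p q => v p.2 ≤ v q.2 ∧ v p.2 ≤ v (p.1 - q.1)
  have r_refl : ∀ p, r p p := fun p => ⟨le_rfl, v_self _ _⟩
  have r_trans : ∀ {p q t}, r p q → r q t → r p t := fun h h' =>
    ⟨h.1.trans h'.1, le_valuation_sub_trans hv_top hv_ultra h.2 (h.1.trans h'.2)⟩
  let P := {p : A × A // p.2 ∈ S ∧ w (b - f p.1) < w (b - f p.1 - f p.2) ∧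
    w (f p.2) = w (b - f p.1) ∧ r (a₀, s₁) p}
  let ball : A × A → Set A := fun p => {x | v p.2 ≤ v (p.1 - x)}
  have ball_mono : ∀ {p q}, r p q → ball q ⊆ ball p := fun h x hx =>
    le_valuation_sub_trans hv_top hv_ultra h.2 (h.1.trans hx)
  obtain ⟨⟨⟨a, s⟩, hs, hlt, heq, hr⟩, hmax⟩ : ∃ m : P, ∀ p : P, r m p → r p m := by
    refine exists_maximal_of_chains_bounded (r := fun p q : P => r p q) (fun C hC => ?_)
      (fun h h' => r_trans h h')
    rcases C.eq_empty_or_nonempty with rfl | ⟨p₀, hp₀⟩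
    · exact ⟨⟨(a₀, s₁), hs₁, hlt₁, heq₁, r_refl _⟩, by simp⟩
    obtain ⟨x, hx⟩ := hA ((fun p : P => ball p) '' C)
      (by rintro _ ⟨p, -, rfl⟩; exact ⟨p.1.1, v p.1.2, rfl⟩)
      (by
        rintro _ ⟨p, hp, rfl⟩ _ ⟨q, hq, rfl⟩ hpq
        rcases hC hp hq (by rintro rfl; exact hpq rfl) with h | h
        · exact Or.inr (ball_mono h)
        · exact Or.inl (ball_mono h))
      ⟨_, p₀, hp₀, rfl⟩
    have hxC : ∀ p ∈ C, v p.1.2 ≤ v (p.1.1 - x) := fun p hp => hx _ ⟨p, hp, rfl⟩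
    obtain ⟨t, ht, htlt, hteq⟩ := approx (b - f x)
      (hne x (ball_mono p₀.2.2.2.2 (hxC p₀ hp₀)))
    have hbound : ∀ p ∈ C, r p (x, t) := fun p hp => by
      refine ⟨(ha _ p.2.1 _ ht).2 ?_, hxC p hp⟩
      rw [hteq]
      refine le_valuation_sub_trans hw_top hw_ultra p.2.2.2.1.le ?_
      rw [← map_sub]
      exact hb _ _ p.2.1 (hxC p hp)
    exact ⟨⟨(x, t), ht, htlt, hteq, r_trans p₀.2.2.2.2 (hbound p₀ hp₀)⟩, hbound⟩
  have hra : r (a, s) (a + s, s) := by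
    refine ⟨le_rfl, ?_⟩
    rw [sub_add_cancel_left, valuation_neg hv_top hv_ultra]
  have hra' : v s₁ ≤ v (a₀ - (a + s)) := (r_trans hr hra).2
  obtain ⟨t, ht, htlt, hteq⟩ := approx _ (hne _ hra')
  have hst : v s < v t := lt_of_lt _ hs _ ht (by rwa [heq, hteq, map_add, ← sub_sub])
  have hat : r (a, s) (a + s, t) := ⟨hst.le, hra.2⟩
  exact hst.not_ge (hmax ⟨(a + s, t), ht, htlt, hteq, r_trans hr hat⟩ hat).1
end

section
/- Let (A, v) and (B, w) be valued abelian groups and f : A → B a group homomorphism, and suppose there is a subset S ⊆ A satisfying conditions (a), (b), (c): (a) for all s, s' ∈ S, v s ≤ v s' if and only if w(f s) ≤ w(f s'); (b) for all a ∈ A and s ∈ S, v a ≥ v s implies w(f a) ≥ w(f s); (c) for every b ∈ B with b ≠ 0 there is some s ∈ S with w(b − f s) > w b. Assume (A, v) is spherically complete, that S is a subgroup of A, and that for every a ∈ A there is some s ∈ S with f s = f a. Then the restriction of f to S is a bijection from S onto B. -/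
section Ultrametric

variable {G Γ : Type*} [AddCommGroup G] [LinearOrder Γ] {u : G → Γ}

theorem map_neg_of_ultrametric [OrderTop Γ] (h_top : ∀ x, u x = ⊤ ↔ x = 0)
    (h_ultra : ∀ x y, min (u x) (u y) ≤ u (x - y)) (x : G) : u (-x) = u x := by
  have key : ∀ y, u y ≤ u (-y) := fun y => by
    simpa [(h_top 0).2 rfl] using h_ultra 0 y
  exact le_antisymm (by simpa using key (-x)) (key x)

theorem map_sub_comm_of_ultrametric [OrderTop Γ] (h_top : ∀ x, u x = ⊤ ↔ x = 0)
    (h_ultra : ∀ x y, min (u x) (u y) ≤ u (x - y)) (x y : G) : u (x - y) = u (y - x) := by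
  rw [← neg_sub, map_neg_of_ultrametric h_top h_ultra]

theorem le_map_sub_trans_of_ultrametric [OrderTop Γ] (h_top : ∀ x, u x = ⊤ ↔ x = 0)
    (h_ultra : ∀ x y, min (u x) (u y) ≤ u (x - y)) {γ : Γ} {x y z : G}
    (hxy : γ ≤ u (x - y)) (hyz : γ ≤ u (y - z)) : γ ≤ u (x - z) := by
  rw [map_sub_comm_of_ultrametric h_top h_ultra] at hyz
  have h := h_ultra (x - y) (z - y)
  rw [sub_sub_sub_cancel_right] at h
  exact (le_min hxy hyz).trans h

theorem map_eq_of_lt_map_sub [OrderTop Γ] (h_top : ∀ x, u x = ⊤ ↔ x = 0)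
    (h_ultra : ∀ x y, min (u x) (u y) ≤ u (x - y)) {x y : G}
    (h : u x < u (x - y)) : u y = u x := by
  apply le_antisymm
  · by_contra! hlt
    have h' := h_ultra (x - y) (-y)
    rw [map_neg_of_ultrametric h_top h_ultra, sub_neg_eq_add, sub_add_cancel] at h'
    exact absurd h' (not_le.2 (lt_min h hlt))
  · have h' := h_ultra x (x - y)
    rwa [min_eq_left h.le, sub_sub_cancel] at h'

end Ultrametric

theorem stmt_6 {A B ΓA ΓB : Type*} [AddCommGroup A] [AddCommGroup B]
    [LinearOrder ΓA] [OrderTop ΓA] [LinearOrder ΓB] [OrderTop ΓB]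
    (v : A → ΓA) (w : B → ΓB)
    (hv_top : ∀ a : A, v a = ⊤ ↔ a = 0)
    (hv_ultra : ∀ a a' : A, min (v a) (v a') ≤ v (a - a'))
    (hw_top : ∀ b : B, w b = ⊤ ↔ b = 0)
    (hw_ultra : ∀ b b' : B, min (w b) (w b') ≤ w (b - b'))
    (f : A →+ B) (S : AddSubgroup A)
    (ha : ∀ s ∈ S, ∀ s' ∈ S, (v s ≤ v s' ↔ w (f s) ≤ w (f s')))
    (hb : ∀ a : A, ∀ s ∈ S, v s ≤ v a → w (f s) ≤ w (f a))
    (hc : ∀ b : B, b ≠ 0 → ∃ s ∈ S, w b < w (b - f s))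
    (hA : SphericallyComplete v)
    (hrep : ∀ a : A, ∃ s ∈ S, f s = f a) :
    Set.BijOn f (S : Set A) (Set.univ : Set B) := by
  refine ⟨fun _ _ => Set.mem_univ _, fun s hs t ht hst => ?_, fun b _ => ?_⟩
  · have h := (ha 0 S.zero_mem (s - t) (S.sub_mem hs ht)).2 (by simp [hst])
    rw [(hv_top 0).2 rfl, top_le_iff, hv_top] at h
    exact sub_eq_zero.1 h
  by_contra hbS
  have hne : ∀ s : S, b - f s ≠ 0 := fun s h => hbS ⟨s, s.2, (sub_eq_zero.1 h).symm⟩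
  choose g hgS hg using fun s : S => hc (b - f s) (hne s)
  have hwg : ∀ s : S, w (f (g s)) = w (b - f s) := fun s =>
    map_eq_of_lt_map_sub hw_top hw_ultra (hg s)
  let X : S → Set A := fun s => {a | v (g s) ≤ v (s - a)}
  have hX : ∀ s t : S, w (b - f s) ≤ w (b - f t) → X t ⊆ X s := by
    intro s t hst a hat
    have hfst : w (f (g s)) ≤ w (f (s - t)) := by
      rw [hwg, map_sub]
      exact le_map_sub_trans_of_ultrametric hw_top hw_ultra
        (map_sub_comm_of_ultrametric hw_top hw_ultra _ _).le hst
    have hst' : v (g s) ≤ v (g t) := (ha _ (hgS s) _ (hgS t)).2 (by rwa [hwg, hwg])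
    exact le_map_sub_trans_of_ultrametric hv_top hv_ultra
      ((ha _ (hgS s) _ (S.sub_mem s.2 t.2)).2 hfst) (hst'.trans hat)
  obtain ⟨a, haX⟩ := hA (Set.range X) (by rintro _ ⟨s, rfl⟩; exact ⟨s, v (g s), rfl⟩)
    (by
      rintro _ ⟨s, rfl⟩ _ ⟨t, rfl⟩ _
      exact (le_total (w (b - f t)) (w (b - f s))).imp (hX t s) (hX s t))
    (Set.range_nonempty X)
  have hle : ∀ s : S, w (b - f s) ≤ w (b - f a) := fun s => by
    have h := hb _ _ (hgS s) (haX (X s) ⟨s, rfl⟩)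
    rw [hwg, map_sub] at h
    exact le_map_sub_trans_of_ultrametric hw_top hw_ultra le_rfl h
  obtain ⟨s, hs, hsa⟩ := hrep a
  have h := hg ⟨s, hs⟩
  rw [sub_sub, ← map_add, hsa] at h
  exact absurd (hle ⟨s + g ⟨s, hs⟩, S.add_mem hs (hgS _)⟩) (not_le.2 h)
end

section
/- Let (A, v) and (B, w) be valued abelian groups and f : A → B a group homomorphism, and let S ⊆ A be a subset satisfying: (a) for all s, s' ∈ S, v s ≤ v s' if and only if w(f s) ≤ w(f s'); and (c) for every b ∈ B with b ≠ 0 there is some s ∈ S with w(b − f s) > w b. Suppose further that S contains an element s₀ with f s₀ = 0. Then (without assuming spherical completeness of A) the assignment v s ↦ w(f s) for s ∈ S defines an order-preserving bijection from {v s | s ∈ S} onto {w b | b ∈ B}; in particular, for every b ∈ B there exists s ∈ S with w b = w(f s). -/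
/-- In an ultrametrically valued abelian group, `b` and `c` have the same value as soon as their
difference has larger value than `b`. -/
theorem eq_of_lt_map_sub {B Γ : Type*} [AddCommGroup B] [LinearOrder Γ] [OrderTop Γ] (w : B → Γ)
    (hw_zero : w 0 = ⊤) (hw_ultra : ∀ b b' : B, min (w b) (w b') ≤ w (b - b'))
    {b c : B} (h : w b < w (b - c)) : w b = w c := by
  apply le_antisymm
  · have hc := hw_ultra b (b - c)
    rwa [sub_sub_cancel, min_eq_left h.le] at hc
  · have hneg := hw_ultra 0 c
    rw [hw_zero, top_inf_eq, zero_sub] at hneg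
    have hb := hw_ultra (b - c) (-c)
    rw [sub_neg_eq_add, sub_add_cancel] at hb
    rcases min_le_iff.mp hb with hb | hb
    · exact absurd h hb.not_gt
    · exact hneg.trans hb

theorem stmt_7 {A B ΓA ΓB : Type*} [AddCommGroup A] [AddCommGroup B]
    [LinearOrder ΓA] [OrderTop ΓA] [LinearOrder ΓB] [OrderTop ΓB]
    (v : A → ΓA) (w : B → ΓB)
    (hv_top : ∀ a : A, v a = ⊤ ↔ a = 0)
    (hv_ultra : ∀ a a' : A, min (v a) (v a') ≤ v (a - a'))
    (hw_top : ∀ b : B, w b = ⊤ ↔ b = 0)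
    (hw_ultra : ∀ b b' : B, min (w b) (w b') ≤ w (b - b'))
    (f : A →+ B) (S : Set A)
    (ha : ∀ s ∈ S, ∀ s' ∈ S, (v s ≤ v s' ↔ w (f s) ≤ w (f s')))
    (hc : ∀ b : B, b ≠ 0 → ∃ s ∈ S, w b < w (b - f s))
    (h0 : ∃ s₀ ∈ S, f s₀ = 0) :
    (∃ φ : (v '' S) → (Set.range w),
      (∀ (s : A) (hs : s ∈ S), (φ ⟨v s, Set.mem_image_of_mem v hs⟩ : ΓB) = w (f s)) ∧
      (∀ x y : v '' S, x ≤ y ↔ φ x ≤ φ y) ∧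
      Function.Bijective φ) ∧
    ∀ b : B, ∃ s ∈ S, w b = w (f s) := by
  have surj : ∀ b : B, ∃ s ∈ S, w b = w (f s) := by
    intro b
    by_cases hb : b = 0
    · obtain ⟨s₀, hs₀, hf⟩ := h0
      exact ⟨s₀, hs₀, by rw [hb, hf]⟩
    · obtain ⟨s, hs, hlt⟩ := hc b hb
      exact ⟨s, hs, eq_of_lt_map_sub w ((hw_top 0).mpr rfl) hw_ultra hlt⟩
  refine ⟨?_, surj⟩
  choose r hrS hr using fun x : v '' S => x.2
  let φ : v '' S → Set.range w := fun x => ⟨w (f (r x)), f (r x), rfl⟩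
  have hφ : ∀ x y : v '' S, x ≤ y ↔ φ x ≤ φ y := by
    intro x y
    change (x : ΓA) ≤ y ↔ w (f (r x)) ≤ w (f (r y))
    rw [← ha _ (hrS x) _ (hrS y), hr, hr]
  have hval : ∀ (s : A) (hs : s ∈ S),
      (φ ⟨v s, Set.mem_image_of_mem v hs⟩ : ΓB) = w (f s) := by
    intro s hs
    have hv := hr ⟨v s, Set.mem_image_of_mem v hs⟩
    exact le_antisymm ((ha _ (hrS _) _ hs).mp hv.le) ((ha _ hs _ (hrS _)).mp hv.ge)
  refine ⟨φ, hval, hφ, ?_, ?_⟩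
  · intro x y hxy
    exact le_antisymm ((hφ x y).mpr hxy.le) ((hφ y x).mpr hxy.ge)
  · rintro ⟨_, b, rfl⟩
    obtain ⟨s, hs, hbs⟩ := surj b
    exact ⟨_, Subtype.ext ((hval s hs).trans hbs.symm)⟩
end

section
/- Let (𝒜, v) be a valued abelian group and let A₁, …, Aₙ be subgroups of 𝒜, each of which is spherically complete with respect to the restriction of v. If the sum A₁ + ⋯ + Aₙ ⊆ 𝒜 is pseudo-direct, then the subgroup A₁ + ⋯ + Aₙ, with the restriction of v, is spherically complete. -/
section Ultrametric

variable {A Γ : Type*} [AddCommGroup A] [LinearOrder Γ] {v : A → Γ}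

theorem le_map_sub_of_le (hv : ∀ a b : A, min (v a) (v b) ≤ v (a - b)) {γ : Γ} {a b : A}
    (ha : γ ≤ v a) (hb : γ ≤ v b) : γ ≤ v (a - b) :=
  (le_min ha hb).trans (hv a b)

theorem le_map_neg_of_le (hv : ∀ a b : A, min (v a) (v b) ≤ v (a - b)) {γ : Γ} {a : A}
    (ha : γ ≤ v a) : γ ≤ v (-a) := by
  have h0 : γ ≤ v (a - a) := le_map_sub_of_le hv ha ha
  rw [sub_self] at h0
  simpa using le_map_sub_of_le hv h0 ha

theorem le_map_sub_comm (hv : ∀ a b : A, min (v a) (v b) ≤ v (a - b)) {γ : Γ} {a b : A}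
    (h : γ ≤ v (a - b)) : γ ≤ v (b - a) := by
  simpa using le_map_neg_of_le hv h

theorem le_map_add_of_le (hv : ∀ a b : A, min (v a) (v b) ≤ v (a - b)) {γ : Γ} {a b : A}
    (ha : γ ≤ v a) (hb : γ ≤ v b) : γ ≤ v (a + b) := by
  simpa using le_map_sub_of_le hv ha (le_map_neg_of_le hv hb)

theorem le_map_sub_trans (hv : ∀ a b : A, min (v a) (v b) ≤ v (a - b)) {γ : Γ} {a b c : A}
    (hab : γ ≤ v (a - b)) (hbc : γ ≤ v (b - c)) : γ ≤ v (a - c) := by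
  simpa using le_map_add_of_le hv hab hbc

end Ultrametric

/-- Any set of balls, given by pairs of a centre and a radius, in which of any two members one has
its centre in the other and the larger radius, has a common point. -/
def NestedBallsMeet {P Γ : Type*} [AddCommGroup P] [LinearOrder Γ] (w : P → Γ) : Prop :=
  ∀ S : Set (P × Γ),
    (∀ x ∈ S, ∀ y ∈ S, (x.2 ≤ y.2 ∧ x.2 ≤ w (x.1 - y.1)) ∨ (y.2 ≤ x.2 ∧ y.2 ≤ w (y.1 - x.1))) →
    ∃ k : P, ∀ x ∈ S, x.2 ≤ w (x.1 - k)

theorem SphericallyComplete.nestedBallsMeet {A Γ : Type*} [AddCommGroup A] [LinearOrder Γ]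
    {v : A → Γ} (hv : ∀ a b : A, min (v a) (v b) ≤ v (a - b)) (h : SphericallyComplete v) :
    NestedBallsMeet v := by
  intro S hS
  rcases S.eq_empty_or_nonempty with rfl | hne
  · exact ⟨0, by simp⟩
  have key : ∀ x y : A × Γ, x.2 ≤ y.2 → x.2 ≤ v (x.1 - y.1) →
      {a | y.2 ≤ v (y.1 - a)} ⊆ {a | x.2 ≤ v (x.1 - a)} := fun x y hr hc a ha =>
    le_map_sub_trans hv hc (hr.trans ha)
  obtain ⟨k, hk⟩ := h ((fun x : A × Γ => {a | x.2 ≤ v (x.1 - a)}) '' S)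
    (by rintro _ ⟨x, -, rfl⟩; exact ⟨x.1, x.2, rfl⟩)
    (by
      rintro _ ⟨x, hx, rfl⟩ _ ⟨y, hy, rfl⟩ -
      rcases hS x hx y hy with ⟨hr, hc⟩ | ⟨hr, hc⟩
      · exact Or.inr (key x y hr hc)
      · exact Or.inl (key y x hr hc))
    (hne.image _)
  exact ⟨k, fun x hx => hk _ ⟨x, hx, rfl⟩⟩

theorem NestedBallsMeet.pi {ι Γ : Type*} [Fintype ι] [LinearOrder Γ] {A : ι → Type*}
    [∀ i, AddCommGroup (A i)] {v : ∀ i, A i → Γ} (hne : (Finset.univ : Finset ι).Nonempty)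
    (h : ∀ i, NestedBallsMeet (v i)) :
    NestedBallsMeet (fun p : ∀ i, A i => Finset.univ.inf' hne (fun i => v i (p i))) := by
  intro S hS
  simp only [Finset.le_inf'_iff, Finset.mem_univ, true_implies, Pi.sub_apply] at hS ⊢
  have hk : ∀ i, ∃ k : A i, ∀ x ∈ S, x.2 ≤ v i (x.1 i - k) := by
    intro i
    obtain ⟨k, hk⟩ := h i ((fun x : (∀ i, A i) × Γ => (x.1 i, x.2)) '' S) (by
      rintro _ ⟨x, hx, rfl⟩ _ ⟨y, hy, rfl⟩
      exact (hS x hx y hy).imp (fun t => ⟨t.1, t.2 i⟩) (fun t => ⟨t.1, t.2 i⟩))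
    exact ⟨k, fun x hx => hk _ ⟨x, hx, rfl⟩⟩
  choose k hk using hk
  exact ⟨k, fun x hx i => hk i x hx⟩

section Immediate

variable {P Q Γ : Type*} [AddCommGroup P] [AddCommGroup Q] [LinearOrder Γ] {w : P → Γ} {v : Q → Γ}

/-- An immediate homomorphism out of a spherically complete group is surjective, and elements
can be lifted without decreasing the value. -/
theorem NestedBallsMeet.exists_lift (hw : ∀ a b : P, min (w a) (w b) ≤ w (a - b))
    (hw0 : ∀ γ, γ ≤ w 0) (hv : ∀ a b : Q, min (v a) (v b) ≤ v (a - b))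
    (hsc : NestedBallsMeet w) (f : P →+ Q) (hf : ∀ p, w p ≤ v (f p))
    (himm : ∀ a, a ≠ 0 → ∃ p, v (f p) = w p ∧ v a < v (a - f p)) (a : Q) :
    ∃ p, f p = a ∧ v a ≤ w p := by
  have hcenter : ∀ p : {p : P // v a ≤ w p}, v a ≤ v (a - f p) := fun p =>
    le_map_sub_of_le hv le_rfl (p.2.trans (hf p))
  have hmono : ∀ p q : P, v (a - f p) ≤ w (p - q) → v (a - f p) ≤ v (a - f q) := by
    intro p q h
    refine le_map_sub_trans hv le_rfl ?_
    rw [← map_sub]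
    exact h.trans (hf _)
  obtain ⟨m, hm⟩ := exists_maximal_of_chains_bounded
    (r := fun p q : {p : P // v a ≤ w p} => v (a - f p) ≤ w (p.1 - q.1))
    (by
      intro C hC
      rcases C.eq_empty_or_nonempty with rfl | ⟨c, hc⟩
      · exact ⟨⟨0, hw0 _⟩, by simp⟩
      obtain ⟨k, hk⟩ := hsc ((fun p : {p : P // v a ≤ w p} => (p.1, v (a - f p))) '' C) (by
        rintro _ ⟨p, hp, rfl⟩ _ ⟨q, hq, rfl⟩
        by_cases hpq : p = q
        · subst hpq
          exact Or.inl ⟨le_rfl, by simpa using hw0 _⟩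
        · exact (hC hp hq hpq).imp (fun h => ⟨hmono _ _ h, h⟩) (fun h => ⟨hmono _ _ h, h⟩))
      have hck : v a ≤ w k := by
        have h1 := (hcenter c).trans (hk _ ⟨c, hc, rfl⟩)
        simpa using le_map_sub_of_le hw c.2 h1
      exact ⟨⟨k, hck⟩, fun p hp => hk _ ⟨p, hp, rfl⟩⟩)
    (fun {p q s} hpq hqs => le_map_sub_trans hw hpq ((hmono _ _ hpq).trans hqs))
  refine ⟨m, ?_, m.2⟩
  by_contra hne
  obtain ⟨g, hg, hlt⟩ := himm (a - f m) (sub_ne_zero.mpr (Ne.symm hne))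
  have h1 : v (a - f m) ≤ w g := by
    rw [← hg]
    simpa using le_map_sub_of_le hv le_rfl hlt.le
  have h2 := hm ⟨m.1 + g, le_map_add_of_le hw m.2 ((hcenter m).trans h1)⟩
    (by simpa using le_map_neg_of_le hw h1)
  simp only [map_add, add_sub_cancel_left, ← sub_sub] at h2
  have h3 : v (a - f m - f g) ≤ v (a - f m) := by
    simpa using le_map_add_of_le hv le_rfl (h2.trans hg.ge)
  exact absurd hlt h3.not_gt

/-- A homomorphic image along which elements lift without decreasing the value inherits spherical
completeness. -/
theorem NestedBallsMeet.sphericallyComplete_of_lift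
    (hw : ∀ a b : P, min (w a) (w b) ≤ w (a - b))
    (hw0 : ∀ γ, γ ≤ w 0) (hv : ∀ a b : Q, min (v a) (v b) ≤ v (a - b)) (hv0 : ∀ γ, γ ≤ v 0)
    (hsc : NestedBallsMeet w) (f : P →+ Q) (hf : ∀ p, w p ≤ v (f p))
    (hlift : ∀ a, ∃ p, f p = a ∧ v a ≤ w p) :
    SphericallyComplete v := by
  intro N hN hchain hne
  by_contra hempty
  have havoid : ∀ x, ∃ Y : N, x ∉ Y.1 := by
    intro x
    by_contra! h
    exact hempty ⟨x, fun Y hY => h ⟨Y, hY⟩⟩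
  choose c r hcr using fun X : N => hN X.1 X.2
  have hmem : ∀ (X : N) x, x ∈ X.1 ↔ r X ≤ v (c X - x) := fun X x => by
    conv_lhs => rw [hcr X]
    rfl
  have hcmem : ∀ X : N, c X ∈ X.1 := fun X => (hmem X _).2 (by simpa using hv0 _)
  have hdist : ∀ (X : N) {x y}, x ∈ X.1 → y ∈ X.1 → r X ≤ v (x - y) := fun X x y hx hy =>
    le_map_sub_trans hv (le_map_sub_comm hv ((hmem X x).1 hx)) ((hmem X y).1 hy)
  have hclosed : ∀ (X : N) {x y}, x ∈ X.1 → r X ≤ v (x - y) → y ∈ X.1 := fun X x y hx hxy =>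
    (hmem X y).2 (le_map_sub_trans hv ((hmem X x).1 hx) hxy)
  have hrad : ∀ X Y : N, Y.1 ⊆ X.1 → r X ≤ r Y := by
    intro X Y hYX
    by_contra! hlt
    have : X.1 ⊆ Y.1 := fun x hx =>
      hclosed Y (hcmem Y) (hlt.le.trans (hdist X (hYX (hcmem Y)) hx))
    exact hlt.ne (congrArg r (Subtype.ext (hYX.antisymm this)))
  have hsub : ∀ (X Y : N) {x}, x ∈ X.1 → x ∉ Y.1 → Y.1 ⊆ X.1 := fun X Y x hx hy =>
    (hchain.total X.2 Y.2).resolve_left fun h => hy (h hx)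
  -- Any point can be moved into a smaller ball without leaving the balls it came from.
  have hmove : ∀ k : P, ∃ (h : P) (Y : N), f h ∈ Y.1 ∧ f k ∉ Y.1 ∧
      ∀ X : N, f k ∈ X.1 → Y.1 ⊆ X.1 ∧ r X ≤ w (k - h) := by
    intro k
    obtain ⟨Y, hY⟩ := havoid (f k)
    obtain ⟨u, hu, huv⟩ := hlift (c Y - f k)
    refine ⟨k + u, Y, by simpa [hu] using hcmem Y, hY, fun X hX => ?_⟩
    have hYX := hsub X Y hX hY
    refine ⟨hYX, ?_⟩
    have := le_map_neg_of_le hw ((hdist X (hYX (hcmem Y)) hX).trans huv)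
    simpa using this
  obtain ⟨m, hm⟩ := exists_maximal_of_chains_bounded
    (r := fun s t : {s : P × N // f s.1 ∈ s.2.1} =>
      t.1.2.1 ⊆ s.1.2.1 ∧ r s.1.2 ≤ w (s.1.1 - t.1.1))
    (by
      intro C hC
      obtain ⟨k, hk⟩ := hsc
        ((fun s : {s : P × N // f s.1 ∈ s.2.1} => (s.1.1, r s.1.2)) '' C) (by
          rintro _ ⟨s, hs, rfl⟩ _ ⟨t, ht, rfl⟩
          by_cases hst : s = t
          · subst hst
            exact Or.inl ⟨le_rfl, by simpa using hw0 _⟩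
          · exact (hC hs ht hst).imp (fun h => ⟨hrad _ _ h.1, h.2⟩)
              (fun h => ⟨hrad _ _ h.1, h.2⟩))
      obtain ⟨h, Y, hY, -, hX⟩ := hmove k
      refine ⟨⟨(h, Y), hY⟩, fun s hs => ?_⟩
      have hsk : r s.1.2 ≤ w (s.1.1 - k) := hk _ ⟨s, hs, rfl⟩
      have hks : f k ∈ s.1.2.1 := hclosed _ s.2 (by
        rw [← map_sub]
        exact hsk.trans (hf _))
      exact ⟨(hX _ hks).1, le_map_sub_trans hw hsk (hX _ hks).2⟩)
    (fun {s t u} hst htu => ⟨htu.1.trans hst.1,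
      le_map_sub_trans hw hst.2 ((hrad _ _ hst.1).trans htu.2)⟩)
  obtain ⟨h, Y, hY, hmY, hX⟩ := hmove m.1.1
  exact hmY ((hm ⟨(h, Y), hY⟩ (hX _ m.2)).1 m.2)

end Immediate

theorem stmt_12 {𝒜 Γ : Type*} [AddCommGroup 𝒜] [LinearOrder Γ] [OrderTop Γ]
    (v : 𝒜 → Γ)
    (hv_top : ∀ a : 𝒜, v a = ⊤ ↔ a = 0)
    (hv_ultra : ∀ a a' : 𝒜, min (v a) (v a') ≤ v (a - a'))
    {n : ℕ} (hn : 0 < n) (A : Fin n → AddSubgroup 𝒜)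
    (hsc : ∀ i, SphericallyComplete (fun x : A i => v x))
    (B : AddSubgroup 𝒜)
    (hB : (B : Set 𝒜) = {a : 𝒜 | ∃ g : Fin n → 𝒜, (∀ i, g i ∈ A i) ∧ a = ∑ i, g i})
    (hpd : ∀ a ∈ B, a ≠ 0 → ∃ g : Fin n → 𝒜, (∀ i, g i ∈ A i) ∧
      v (∑ i, g i) = Finset.univ.inf' ⟨⟨0, hn⟩, Finset.mem_univ _⟩ (fun i => v (g i)) ∧
      v a < v (a - ∑ i, g i)) :
    SphericallyComplete (fun x : B => v x) := by
  have hne : (Finset.univ : Finset (Fin n)).Nonempty := ⟨⟨0, hn⟩, Finset.mem_univ _⟩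
  have hv0 : v 0 = ⊤ := (hv_top 0).2 rfl
  have hmem : ∀ p : ∀ i, A i, ∑ i, (p i : 𝒜) ∈ B := fun p => by
    rw [← SetLike.mem_coe, hB]
    exact ⟨fun i => p i, fun i => (p i).2, rfl⟩
  let f : (∀ i, A i) →+ B :=
    { toFun := fun p => ⟨∑ i, (p i : 𝒜), hmem p⟩
      map_zero' := by ext; simp
      map_add' := fun p q => by ext; simp [Finset.sum_add_distrib] }
  let w : (∀ i, A i) → Γ := fun p => Finset.univ.inf' hne (fun i => v (p i))
  have hw : ∀ p q, min (w p) (w q) ≤ w (p - q) := fun p q =>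
    Finset.le_inf' _ _ fun i hi =>
      (min_le_min (Finset.inf'_le _ hi) (Finset.inf'_le _ hi)).trans (hv_ultra (p i) (q i))
  have hw0 : ∀ γ, γ ≤ w 0 := fun γ => Finset.le_inf' _ _ fun i _ => by simp [hv0]
  have hvB : ∀ a b : B, min (v a) (v b) ≤ v (a - b : B) := fun a b => hv_ultra a b
  have hf : ∀ p, w p ≤ v (f p) := fun p =>
    Finset.sum_induction (fun i => (p i : 𝒜)) (fun x => w p ≤ v x)
      (fun _ _ => le_map_add_of_le hv_ultra) (by simp [hv0])
      (fun i hi => Finset.inf'_le _ hi)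
  have hmeet : NestedBallsMeet w := NestedBallsMeet.pi (v := fun i (x : A i) => v x) hne fun i =>
    (hsc i).nestedBallsMeet fun a b => hv_ultra a b
  refine hmeet.sphericallyComplete_of_lift hw hw0 hvB (by simp [hv0]) f hf
    (hmeet.exists_lift hw hw0 hvB f hf fun a ha => ?_)
  obtain ⟨g, hg, heq, hlt⟩ := hpd a a.2 (by simpa using ha)
  exact ⟨fun i => ⟨g i, hg i⟩, heq, hlt⟩
end

section
/- Let (A, v) be a spherically complete valued abelian group and let α ∈ Γ be a value attained by v (α = v a₀ for some a₀ ∈ A). Consider the quotient group A/B_α(0), where B_α(0) = {a ∈ A | v a ≥ α} is a subgroup of A, endowed with the canonical quotient valuation w defined by w(a + B_α(0)) = v a if v a < α, and w(a + B_α(0)) = ⊤ if v a ≥ α (this is well defined). Then (A/B_α(0), w) is a spherically complete valued abelian group. -/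
theorem stmt_14 {A Γ : Type*} [AddCommGroup A] [LinearOrder Γ] [OrderTop Γ]
    (v : A → Γ)
    (hv_top : ∀ a : A, v a = ⊤ ↔ a = 0)
    (hv_ultra : ∀ a a' : A, min (v a) (v a') ≤ v (a - a'))
    (hA : SphericallyComplete v)
    (α : Γ) (hα : α ∈ Set.range v)
    (N : AddSubgroup A) (hN : (N : Set A) = {a : A | α ≤ v a})
    (w : A ⧸ N → Γ)
    (hw : ∀ a : A, w (QuotientAddGroup.mk a) = if v a < α then v a else ⊤) :
    (∀ x : A ⧸ N, w x = ⊤ ↔ x = 0) ∧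
    (∀ x y : A ⧸ N, min (w x) (w y) ≤ w (x - y)) ∧
    SphericallyComplete w := by
  have mem_N : ∀ a, a ∈ N ↔ α ≤ v a := fun a => by
    rw [← SetLike.mem_coe, hN, Set.mem_ofPred_eq]
  have le_w : ∀ γ a, γ ≤ w (QuotientAddGroup.mk a) ↔ min γ α ≤ v a := by
    intro γ a
    rw [hw]
    split_ifs with h
    · simp [h.not_ge]
    · simp [not_lt.mp h]
  refine ⟨fun x => ?_, fun x y => ?_, fun S hS hchain hne => ?_⟩
  · obtain ⟨a, rfl⟩ := QuotientAddGroup.mk_surjective x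
    rw [QuotientAddGroup.eq_zero_iff, mem_N, ← top_le_iff, le_w, min_eq_right le_top]
  · obtain ⟨a, rfl⟩ := QuotientAddGroup.mk_surjective x
    obtain ⟨b, rfl⟩ := QuotientAddGroup.mk_surjective y
    rw [← QuotientAddGroup.mk_sub, le_w, inf_inf_distrib_right]
    exact (min_le_min ((le_w _ a).mp le_rfl) ((le_w _ b).mp le_rfl)).trans (hv_ultra a b)
  · obtain ⟨a, ha⟩ := hA ((fun X => QuotientAddGroup.mk ⁻¹' X) '' S) (by
      rintro _ ⟨X, hX, rfl⟩
      obtain ⟨x, γ, rfl⟩ := hS X hX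
      obtain ⟨b, rfl⟩ := QuotientAddGroup.mk_surjective x
      refine ⟨b, min γ α, Set.ext fun c => ?_⟩
      simp only [Set.mem_preimage, Set.mem_ofPred_eq]
      rw [← QuotientAddGroup.mk_sub, le_w])
      (hchain.image_of_map_rel _ _ _ fun _ _ h => Set.preimage_mono h) (hne.image _)
    exact ⟨QuotientAddGroup.mk a, fun X hX => ha _ (Set.mem_image_of_mem _ hX)⟩
end
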